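/- arXiv:2012.01309 — 7 statements merged into one kernel-verified Lean document; each statement's English description precedes it below -/
import Mathlib

section
/- Let M be a finite monoid in DA. Let e ∈ M be idempotent and let a_1, …, a_k ∈ M be elements such that e ≤_J a_i for every 1 ≤ i ≤ k. Then e * a_1 * ⋯ * a_k * e = e. -/
/-- Green's `J`-preorder: `s ≤_J t` iff there exist `x, y` with `s = x * t * y`. -/
def Jle {M : Type*} [Monoid M] (s t : M) : Prop := ∃ x y : M, s = x * t * y

/-- A finite monoid is in `DA` if for all `x, y, z` and every `n ≥ 1` such that
`(x*y*z)^n` is idempotent, one has `(x*y*z)^n * y * (x*y*z)^n = (x*y*z)^n`. -/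
def InDA (M : Type*) [Monoid M] : Prop :=
  ∀ x y z : M, ∀ n : ℕ, 1 ≤ n → IsIdempotentElem ((x * y * z) ^ n) →
    (x * y * z) ^ n * y * (x * y * z) ^ n = (x * y * z) ^ n

theorem InDA.mul_mul_self_of_jle {M : Type*} [Monoid M] (hDA : InDA M) {e a : M}
    (he : IsIdempotentElem e) (h : Jle e a) : e * a * e = e := by
  obtain ⟨x, y, hxy⟩ := h
  have key := hDA x a y 1 le_rfl
  rw [pow_one, ← hxy] at key
  exact key he

theorem InDA.mul_mul_mul_self {M : Type*} [Monoid M] (hDA : InDA M) {e a b : M}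
    (ha : e * a * e = e) (hb : e * b * e = e) :
    e * (a * b) * e = e := by
  have hbe : 1 * (b * e * a) * e = b * e := by
    rw [one_mul, mul_assoc b, mul_assoc b, ha]
  have hidem : IsIdempotentElem (b * e) := by
    rw [IsIdempotentElem, mul_assoc b, ← mul_assoc e, hb]
  have key := hDA 1 (b * e * a) e 1 le_rfl
  rw [pow_one, hbe] at key
  calc e * (a * b) * e = e * b * e * b * e * (a * b) * e := by rw [hb, hb]
    _ = e * (b * e * (b * e * a) * (b * e)) := by simp only [mul_assoc]
    _ = e := by rw [key hidem, ← mul_assoc, hb]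

theorem stmt0 {M : Type*} [Monoid M] [Finite M] (hDA : InDA M)
    (e : M) (he : IsIdempotentElem e) (l : List M) (h : ∀ a ∈ l, Jle e a) :
    e * l.prod * e = e := by
  induction l with
  | nil => rw [List.prod_nil, mul_one, he.eq]
  | cons a l ih =>
    rw [List.prod_cons]
    exact hDA.mul_mul_mul_self (hDA.mul_mul_self_of_jle he (h a List.mem_cons_self))
      (ih fun b hb => h b (List.mem_cons_of_mem a hb))
end

section
/- Let M be a finite monoid in DA and let μ : A* → M be a monoid homomorphism from the free monoid over a finite alphabet A. Let u, v, w ∈ A*. If μ(u*v) R μ(u) and alph(w) ⊆ alph(v), then μ(u*w) R μ(u). Dually, if μ(v*u) L μ(u) and alph(w) ⊆ alph(v), then μ(w*u) L μ(u). -/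
/-- Green's `R`-preorder: `s ≤_R t` iff there exists `y` with `s = t * y`. -/
def Rle {M : Type*} [Monoid M] (s t : M) : Prop := ∃ y : M, s = t * y

/-- Green's `L`-preorder: `s ≤_L t` iff there exists `x` with `s = x * t`. -/
def Lle {M : Type*} [Monoid M] (s t : M) : Prop := ∃ x : M, s = x * t

/-- Green's `R`-equivalence. -/
def Req {M : Type*} [Monoid M] (s t : M) : Prop := Rle s t ∧ Rle t s

/-- Green's `L`-equivalence. -/
def Leq {M : Type*} [Monoid M] (s t : M) : Prop := Lle s t ∧ Lle t s

/-- The set of letters occurring in a word. -/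
def alph {A : Type*} (u : FreeMonoid A) : Set A := {a | a ∈ FreeMonoid.toList u}

open MulOpposite in
theorem InDA.mulOpposite {M : Type*} [Monoid M] (hDA : InDA M) : InDA Mᵐᵒᵖ := by
  intro x y z n hn hidem
  have hu : unop ((x * y * z) ^ n) = (unop z * unop y * unop x) ^ n := by
    simp [mul_assoc]
  have h := hDA (unop z) (unop y) (unop x) n hn
    (by rw [← hu, IsIdempotentElem, ← unop_mul, hidem.eq])
  apply unop_injective
  rw [unop_mul, unop_mul, hu, ← mul_assoc, h]

theorem exists_isIdempotentElem_pow {M : Type*} [Monoid M] [Finite M] (a : M) :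
    ∃ n : ℕ, 1 ≤ n ∧ IsIdempotentElem (a ^ n) := by
  obtain ⟨m, k, hmk, h⟩ : ∃ m k : ℕ, m < k ∧ a ^ m = a ^ k := by
    obtain ⟨m, k, hne, h⟩ := Finite.exists_ne_map_eq_of_infinite (fun n : ℕ => a ^ n)
    rcases hne.lt_or_gt with hlt | hlt
    exacts [⟨m, k, hlt, h⟩, ⟨k, m, hlt, h.symm⟩]
  obtain ⟨p, rfl⟩ := Nat.exists_eq_add_of_lt hmk
  have period : ∀ j i, m ≤ i → a ^ (i + j * (p + 1)) = a ^ i := by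
    intro j
    induction j with
    | zero => simp
    | succ j ih =>
      intro i hi
      obtain ⟨r, rfl⟩ := Nat.exists_eq_add_of_le hi
      have hstep : m + r + (j + 1) * (p + 1) = (m + p + 1) + (r + j * (p + 1)) := by ring
      rw [hstep, pow_add, ← h, ← pow_add, ← add_assoc, ih _ hi]
  refine ⟨(m + 1) * (p + 1), Nat.mul_pos m.succ_pos p.succ_pos, ?_⟩
  rw [IsIdempotentElem, ← pow_add]
  exact period _ _ (by nlinarith)

/-- In a finite monoid in `DA`, a factor of a right stabilizer of `s` can be undone at `s`. -/
theorem InDA.exists_mul_eq_of_stabilizer {M : Type*} [Monoid M] [Finite M] (hDA : InDA M)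
    {s x b z : M} (h : s * (x * b * z) = s) : ∃ t, s * b * t = s := by
  obtain ⟨n, hn, he⟩ := exists_isIdempotentElem_pow (x * b * z)
  have hs : ∀ k : ℕ, s * (x * b * z) ^ k = s := by
    intro k
    induction k with
    | zero => simp
    | succ k ih => rw [pow_succ, ← mul_assoc, ih, h]
  refine ⟨(x * b * z) ^ n, ?_⟩
  conv_lhs => rw [← hs n]
  rw [mul_assoc s, mul_assoc s, hDA x b z n hn he, hs]

theorem InDA.exists_mul_prod_eq {M : Type*} [Monoid M] [Finite M] (hDA : InDA M) (s : M)
    (l : List M) (h : ∀ b ∈ l, ∃ x z, s * (x * b * z) = s) : ∃ t, s * l.prod * t = s := by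
  induction l using List.reverseRecOn with
  | nil => exact ⟨1, by simp⟩
  | append_singleton l b ih =>
    obtain ⟨t, ht⟩ := ih fun c hc => h c (by simp [hc])
    obtain ⟨x, z, hb⟩ := h b (by simp)
    have hstab : s * l.prod * ((t * x) * b * (z * l.prod)) = s * l.prod :=
      calc _ = s * l.prod * t * (x * b * z) * l.prod := by simp only [mul_assoc]
        _ = s * l.prod := by rw [ht, hb]
    obtain ⟨r, hr⟩ := hDA.exists_mul_eq_of_stabilizer hstab
    exact ⟨r * t, by simpa [← mul_assoc, hr] using ht⟩

open MulOpposite in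
theorem InDA.exists_prod_mul_eq {M : Type*} [Monoid M] [Finite M] (hDA : InDA M) (s : M)
    (l : List M) (h : ∀ b ∈ l, ∃ x z, x * b * z * s = s) : ∃ t, t * (l.prod * s) = s := by
  have : Finite Mᵐᵒᵖ := Finite.of_equiv M opEquiv
  obtain ⟨t, ht⟩ := hDA.mulOpposite.exists_mul_prod_eq (op s) (l.map op).reverse (by
    intro b hb
    obtain ⟨c, hc, rfl⟩ : ∃ c ∈ l, op c = b := by simpa using hb
    obtain ⟨x, z, hxz⟩ := h c hc
    exact ⟨op z, op x, unop_injective (by simpa [mul_assoc] using hxz)⟩)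
  rw [← op_list_prod] at ht
  exact ⟨unop t, by simpa using congrArg unop ht⟩

theorem FreeMonoid.map_eq_prod_toList {A M : Type*} [Monoid M] (μ : FreeMonoid A →* M)
    (w : FreeMonoid A) : μ w = (w.toList.map fun a => μ (FreeMonoid.of a)).prod := by
  conv_lhs => rw [← FreeMonoid.lift_restrict μ]
  rw [FreeMonoid.lift_apply]
  rfl

theorem exists_map_eq_of_mem_alph {A M : Type*} [Monoid M] (μ : FreeMonoid A →* M)
    {v : FreeMonoid A} {a : A} (ha : a ∈ alph v) :
    ∃ x z, μ v = x * μ (FreeMonoid.of a) * z := by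
  obtain ⟨p, q, hpq⟩ := List.append_of_mem ha
  refine ⟨μ (FreeMonoid.ofList p), μ (FreeMonoid.ofList q), ?_⟩
  rw [← map_mul, ← map_mul]
  congr 1
  apply FreeMonoid.toList.injective
  simp [hpq]

theorem stmt1 {A M : Type*} [Finite A] [Monoid M] [Finite M] (hDA : InDA M)
    (μ : FreeMonoid A →* M) (u v w : FreeMonoid A) :
    (Req (μ (u * v)) (μ u) → alph w ⊆ alph v → Req (μ (u * w)) (μ u)) ∧
    (Leq (μ (v * u)) (μ u) → alph w ⊆ alph v → Leq (μ (w * u)) (μ u)) := by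
  constructor
  · rintro ⟨-, y, hy⟩ hwv
    refine ⟨⟨μ w, map_mul μ u w⟩, ?_⟩
    obtain ⟨t, ht⟩ := hDA.exists_mul_prod_eq (μ u)
      (w.toList.map fun a => μ (FreeMonoid.of a)) (by
        intro b hb
        obtain ⟨a, ha, rfl⟩ := List.mem_map.1 hb
        obtain ⟨x, z, hv⟩ := exists_map_eq_of_mem_alph μ (hwv ha)
        refine ⟨x, z * y, ?_⟩
        rw [← mul_assoc _ z, ← hv, ← mul_assoc, ← map_mul, ← hy])
    rw [← FreeMonoid.map_eq_prod_toList, ← map_mul] at ht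
    exact ⟨t, ht.symm⟩
  · rintro ⟨-, y, hy⟩ hwv
    refine ⟨⟨μ w, map_mul μ w u⟩, ?_⟩
    obtain ⟨t, ht⟩ := hDA.exists_prod_mul_eq (μ u)
      (w.toList.map fun a => μ (FreeMonoid.of a)) (by
        intro b hb
        obtain ⟨a, ha, rfl⟩ := List.mem_map.1 hb
        obtain ⟨x, z, hv⟩ := exists_map_eq_of_mem_alph μ (hwv ha)
        refine ⟨y * x, z, ?_⟩
        rw [mul_assoc y, mul_assoc y, ← hv, mul_assoc, ← map_mul, ← hy])
    rw [← FreeMonoid.map_eq_prod_toList, ← map_mul] at ht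
    exact ⟨t, ht.symm⟩
end

section
/- Let M be an ordered monoid. The relation ≲ on linked pairs of M is a preorder: (s,e) ≲ (s,e) for every linked pair (s,e), and if (s,e), (r,g), (t,f) are linked pairs with (s,e) ≲ (r,g) and (r,g) ≲ (t,f), then (s,e) ≲ (t,f). -/
/-- A pair `(s, e)` is linked if `s * e = s` and `e` is idempotent. -/
def IsLinked {M : Type*} [Monoid M] (s e : M) : Prop := s * e = s ∧ IsIdempotentElem e

/-- Conjugacy of linked pairs: `(s, e) ∼ (t, f)` iff there exist `x, y` with
`s * x = t`, `x * y = e` and `y * x = f`. -/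
def ConjPair {M : Type*} [Monoid M] (s e t f : M) : Prop :=
  ∃ x y : M, s * x = t ∧ x * y = e ∧ y * x = f

/-- `(s, e) ≲ (t, f)` iff there exists `r` such that `(r, f)` is a linked pair,
`(s, e) ∼ (r, f)` and `r ≤ t`. -/
def Lesssim {M : Type*} [Monoid M] [PartialOrder M] (s e t f : M) : Prop :=
  ∃ r : M, IsLinked r f ∧ ConjPair s e r f ∧ r ≤ t

theorem stmt2 {M : Type*} [Monoid M] [PartialOrder M]
    [CovariantClass M M (· * ·) (· ≤ ·)]
    [CovariantClass M M (Function.swap (· * ·)) (· ≤ ·)] :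
    (∀ s e : M, IsLinked s e → Lesssim s e s e) ∧
    (∀ s e r g t f : M, IsLinked s e → IsLinked r g → IsLinked t f →
      Lesssim s e r g → Lesssim r g t f → Lesssim s e t f) := by
  refine ⟨fun s e h => ⟨s, h, ⟨e, e, h.1, h.2, h.2⟩, le_rfl⟩, ?_⟩
  rintro s e r g t f ⟨-, he⟩ - ⟨-, hf⟩ ⟨p, ⟨hpg, -⟩, ⟨x, y, hsx, hxy, hyx⟩, hpr⟩
    ⟨q, -, ⟨u, v, hru, huv, hvu⟩, hqt⟩
  refine ⟨p * u, ⟨?_, hf⟩, ⟨x * u, v * y, ?_, ?_, ?_⟩, ?_⟩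
  · calc p * u * f = p * (u * v) * u := by simp only [← hvu, mul_assoc]
      _ = p * u := by rw [huv, hpg]
  · rw [← mul_assoc, hsx]
  · calc x * u * (v * y) = x * (u * v) * y := by simp only [mul_assoc]
      _ = x * y * (x * y) := by rw [huv, ← hyx]; simp only [mul_assoc]
      _ = e := by rw [hxy, he.eq]
  · calc v * y * (x * u) = v * (y * x) * u := by simp only [mul_assoc]
      _ = v * u * (v * u) := by rw [hyx, ← huv]; simp only [mul_assoc]
      _ = f := by rw [hvu, hf.eq]
  · exact (mul_le_mul_left hpr u).trans (hru.trans_le hqt)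
end

section
/- Let M be an ordered monoid. The relation ≼_KD on M is a stable preorder: it is reflexive, transitive, and u ≼_KD v implies x*u*y ≼_KD x*v*y for all x,y ∈ M. -/
/-- The relation `u ≼_KD v`: for all `s, t`,
(i) if `s R s*v*t` then `s R s*u*t`;
(ii) if `s*v*t L t` then `s*u*t L t`;
(iii) if `s R s*v` and `v*t L t` then `s*u*t ≤ s*v*t`. -/
def PrecKD {M : Type*} [Monoid M] [PartialOrder M] (u v : M) : Prop :=
  ∀ s t : M,
    (Req s (s * v * t) → Req s (s * u * t)) ∧
    (Leq (s * v * t) t → Leq (s * u * t) t) ∧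
    (Req s (s * v) → Leq (v * t) t → s * u * t ≤ s * v * t)

theorem req_mul_iff {M : Type*} [Monoid M] {s m : M} :
    Req s (s * m) ↔ ∃ z : M, s = s * m * z :=
  ⟨fun h => h.1, fun h => ⟨h, m, rfl⟩⟩

theorem leq_mul_iff {M : Type*} [Monoid M] {m t : M} :
    Leq (m * t) t ↔ ∃ z : M, t = z * (m * t) :=
  ⟨fun h => h.2, fun h => ⟨⟨m, rfl⟩, h⟩⟩

theorem Req.of_mul {M : Type*} [Monoid M] {s a b : M} (h : Req s (s * (a * b))) :
    Req s (s * a) := by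
  obtain ⟨z, hz⟩ := h.1
  exact req_mul_iff.2 ⟨b * z, by simpa only [mul_assoc] using hz⟩

theorem Leq.of_mul {M : Type*} [Monoid M] {a b t : M} (h : Leq (a * b * t) t) :
    Leq (b * t) t := by
  obtain ⟨z, hz⟩ := h.2
  exact leq_mul_iff.2 ⟨z * a, by simpa only [mul_assoc] using hz⟩

/-- Moving a right factor across: `s R s*x*m` iff `s R s*x` and `s*x R s*x*m`. -/
theorem req_mul_mul_iff {M : Type*} [Monoid M] {s x m : M} :
    Req s (s * (x * m)) ↔ Req s (s * x) ∧ Req (s * x) (s * x * m) := by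
  constructor
  · intro h
    refine ⟨h.of_mul, ?_⟩
    obtain ⟨z, hz⟩ := h.1
    refine req_mul_iff.2 ⟨z * x, ?_⟩
    simpa only [mul_assoc] using congrArg (· * x) hz
  · rintro ⟨⟨⟨z, hz⟩, -⟩, ⟨w, hw⟩, -⟩
    refine req_mul_iff.2 ⟨w * z, ?_⟩
    simpa only [mul_assoc] using hz.trans (congrArg (· * z) hw)

/-- Moving a left factor across: `m*y*t L t` iff `y*t L t` and `m*y*t L y*t`. -/
theorem leq_mul_mul_iff {M : Type*} [Monoid M] {m y t : M} :
    Leq (m * y * t) t ↔ Leq (y * t) t ∧ Leq (m * (y * t)) (y * t) := by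
  constructor
  · intro h
    refine ⟨h.of_mul, ?_⟩
    obtain ⟨z, hz⟩ := h.2
    refine leq_mul_iff.2 ⟨y * z, ?_⟩
    simpa only [mul_assoc] using congrArg (y * ·) hz
  · rintro ⟨⟨-, z, hz⟩, -, w, hw⟩
    refine leq_mul_iff.2 ⟨z * w, ?_⟩
    simpa only [mul_assoc] using hz.trans (congrArg (z * ·) hw)

theorem PrecKD.refl {M : Type*} [Monoid M] [PartialOrder M] (u : M) : PrecKD u u :=
  fun _ _ => ⟨id, id, fun _ _ => le_rfl⟩

theorem PrecKD.trans {M : Type*} [Monoid M] [PartialOrder M] {u v w : M}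
    (huv : PrecKD u v) (hvw : PrecKD v w) : PrecKD u w := by
  intro s t
  refine ⟨fun h => (huv s t).1 ((hvw s t).1 h), fun h => (huv s t).2.1 ((hvw s t).2.1 h),
    fun hs ht => ?_⟩
  have hs' : Req s (s * v) := by simpa using (hvw s 1).1 (by simpa using hs)
  have ht' : Leq (v * t) t := by simpa using (hvw 1 t).2.1 (by simpa using ht)
  exact ((huv s t).2.2 hs' ht').trans ((hvw s t).2.2 hs ht)

theorem PrecKD.mul_mul {M : Type*} [Monoid M] [PartialOrder M] {u v : M}
    (huv : PrecKD u v) (x y : M) : PrecKD (x * u * y) (x * v * y) := by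
  intro s t
  have key (m : M) : s * (x * m * y) * t = s * x * m * (y * t) := by simp only [mul_assoc]
  have keyR (m : M) : s * x * m * (y * t) = s * (x * (m * (y * t))) := by simp only [mul_assoc]
  have keyL (m : M) : s * x * m * (y * t) = s * x * m * y * t := by simp only [mul_assoc]
  obtain ⟨hR, hL, hle⟩ := huv (s * x) (y * t)
  simp only [key]
  refine ⟨fun h => ?_, fun h => ?_, fun hs ht => hle ?_ ?_⟩
  · rw [keyR, req_mul_mul_iff, ← mul_assoc (s * x)] at h ⊢
    exact ⟨h.1, hR h.2⟩
  · rw [keyL, leq_mul_mul_iff] at h ⊢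
    exact ⟨h.1, hL h.2⟩
  · rw [mul_assoc x, req_mul_mul_iff] at hs
    exact hs.2.of_mul
  · rw [leq_mul_mul_iff] at ht
    exact ht.2.of_mul

theorem stmt4 {M : Type*} [Monoid M] [PartialOrder M]
    [CovariantClass M M (· * ·) (· ≤ ·)]
    [CovariantClass M M (Function.swap (· * ·)) (· ≤ ·)] :
    (∀ u : M, PrecKD u u) ∧
    (∀ u v w : M, PrecKD u v → PrecKD v w → PrecKD u w) ∧
    (∀ u v x y : M, PrecKD u v → PrecKD (x * u * y) (x * v * y)) := by
  exact ⟨PrecKD.refl, fun _ _ _ => PrecKD.trans, fun _ _ x y h => h.mul_mul x y⟩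
end

section
/- Let M be an ordered monoid and let s, t, u, v ∈ M. If s R s*v, v*t L t, and u ≡_KD v, then s*u*t = s*v*t. -/
/-- `u ≡_KD v` iff `u ≼_KD v` and `v ≼_KD u`. -/
def EquivKD {M : Type*} [Monoid M] [PartialOrder M] (u v : M) : Prop :=
  PrecKD u v ∧ PrecKD v u

theorem stmt5 {M : Type*} [Monoid M] [PartialOrder M]
    [CovariantClass M M (· * ·) (· ≤ ·)]
    [CovariantClass M M (Function.swap (· * ·)) (· ≤ ·)]
    (s t u v : M) (hR : Req s (s * v)) (hL : Leq (v * t) t) (hKD : EquivKD u v) :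
    s * u * t = s * v * t := by
  have hRu : Req s (s * u) := by simpa using (hKD.1 s 1).1 (by simpa using hR)
  have hLu : Leq (u * t) t := by simpa using (hKD.1 1 t).2.1 (by simpa using hL)
  exact le_antisymm ((hKD.1 s t).2.2 hR hL) ((hKD.2 s t).2.2 hRu hLu)
end

section
/- Let M be a finite ordered monoid in DA and let v ∈ M. If 1 ≤ v, then 1 ≼_KD v. -/
theorem mul_pow_eq_self_of_mul_eq_self {M : Type*} [Monoid M] {s a : M} (h : s * a = s) (n : ℕ) :
    s * a ^ n = s := by
  induction n with
  | zero => simp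
  | succ n ih => rw [pow_succ, ← mul_assoc, ih, h]

theorem pow_mul_eq_self_of_mul_eq_self {M : Type*} [Monoid M] {t a : M} (h : a * t = t) (n : ℕ) :
    a ^ n * t = t := by
  induction n with
  | zero => simp
  | succ n ih => rw [pow_succ, mul_assoc, h, ih]

/-- In a monoid in `DA`, a factor of a right stabiliser of `s` can be cancelled up to `R`. -/
theorem InDA.exists_eq_mul_of_mul_eq_self {M : Type*} [Monoid M] [Finite M] (hDA : InDA M)
    {s v q : M} (h : s * (v * q) = s) : ∃ w : M, s = s * q * w := by
  obtain ⟨n, hn, he⟩ := exists_isIdempotentElem_pow (v * q)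
  have hs := mul_pow_eq_self_of_mul_eq_self h n
  have hd := hDA v q 1 n hn (by rwa [mul_one])
  rw [mul_one] at hd
  refine ⟨(v * q) ^ n, ?_⟩
  calc s = s * (v * q) ^ n := hs.symm
    _ = s * ((v * q) ^ n * q * (v * q) ^ n) := by rw [hd]
    _ = s * (v * q) ^ n * q * (v * q) ^ n := by simp only [mul_assoc]
    _ = s * q * (v * q) ^ n := by rw [hs]

/-- In a monoid in `DA`, a factor of a left stabiliser of `t` can be cancelled up to `L`. -/
theorem InDA.exists_eq_mul_of_mul_eq_self' {M : Type*} [Monoid M] [Finite M] (hDA : InDA M)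
    {t v p : M} (h : p * v * t = t) : ∃ w : M, t = w * (p * t) := by
  obtain ⟨n, hn, he⟩ := exists_isIdempotentElem_pow (p * v)
  have ht := pow_mul_eq_self_of_mul_eq_self h n
  have hd := hDA 1 p v n hn (by rwa [one_mul])
  rw [one_mul] at hd
  refine ⟨(p * v) ^ n, ?_⟩
  calc t = (p * v) ^ n * t := ht.symm
    _ = (p * v) ^ n * p * (p * v) ^ n * t := by rw [hd]
    _ = (p * v) ^ n * (p * ((p * v) ^ n * t)) := by simp only [mul_assoc]
    _ = (p * v) ^ n * (p * t) := by rw [ht]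

theorem stmt7 {M : Type*} [Monoid M] [PartialOrder M] [Finite M]
    [CovariantClass M M (· * ·) (· ≤ ·)]
    [CovariantClass M M (Function.swap (· * ·)) (· ≤ ·)]
    (hDA : InDA M) (v : M) (h : (1 : M) ≤ v) : PrecKD 1 v := by
  intro s t
  simp only [mul_one]
  refine ⟨?_, ?_, fun _ _ => ?_⟩
  · rintro ⟨⟨y, hy⟩, -⟩
    obtain ⟨w, hw⟩ := hDA.exists_eq_mul_of_mul_eq_self (s := s) (v := v) (q := t * y)
      (by simpa only [mul_assoc] using hy.symm)
    exact ⟨⟨y * w, by simpa only [mul_assoc] using hw⟩, ⟨t, rfl⟩⟩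
  · rintro ⟨-, ⟨x, hx⟩⟩
    obtain ⟨w, hw⟩ := hDA.exists_eq_mul_of_mul_eq_self' (t := t) (v := v) (p := x * s)
      (by simpa only [mul_assoc] using hx.symm)
    exact ⟨⟨s, rfl⟩, ⟨w * x, by simpa only [mul_assoc] using hw⟩⟩
  · have hsv : s * 1 ≤ s * v := CovariantClass.elim (μ := (· * ·)) s h
    rw [mul_one] at hsv
    exact CovariantClass.elim (μ := Function.swap (· * ·)) t hsv
end

section
/- Let M be a finite ordered monoid and let n ≥ 1 be an integer such that s^n is idempotent for every s ∈ M. Let u, v ∈ M with u ≼_KD v. Then for all x, y ∈ M: (v*x)^n * u * (y*v)^n ≤ (v*x)^n * v * (y*v)^n. -/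
theorem stmt8 {M : Type*} [Monoid M] [PartialOrder M] [Finite M]
    [CovariantClass M M (· * ·) (· ≤ ·)]
    [CovariantClass M M (Function.swap (· * ·)) (· ≤ ·)]
    (n : ℕ) (hn : 1 ≤ n) (hidem : ∀ s : M, IsIdempotentElem (s ^ n))
    (u v : M) (h : PrecKD u v) :
    ∀ x y : M, (v * x) ^ n * u * (y * v) ^ n ≤ (v * x) ^ n * v * (y * v) ^ n := by
  intro x y
  obtain ⟨m, rfl⟩ := Nat.exists_eq_add_of_le' hn
  refine (h _ _).2.2 ⟨⟨x * (v * x) ^ m, ?_⟩, v, rfl⟩ ⟨⟨v, rfl⟩, (y * v) ^ m * y, ?_⟩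
  · calc (v * x) ^ (m + 1) = (v * x) ^ (m + 1) * (v * x) ^ (m + 1) := (hidem (v * x)).eq.symm
      _ = (v * x) ^ (m + 1) * (v * x * (v * x) ^ m) := by rw [← pow_succ']
      _ = (v * x) ^ (m + 1) * v * (x * (v * x) ^ m) := by simp only [mul_assoc]
  · calc (y * v) ^ (m + 1) = (y * v) ^ (m + 1) * (y * v) ^ (m + 1) := (hidem (y * v)).eq.symm
      _ = (y * v) ^ m * (y * v) * (y * v) ^ (m + 1) := by rw [← pow_succ]
      _ = (y * v) ^ m * y * (v * (y * v) ^ (m + 1)) := by simp only [mul_assoc]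
end
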